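/- For every positive integer m and every θ ∈ (0,1), L_m(θ) = L_{m+1}(θ) if and only if θ^((m+1)/2) + θ^(m/2) = 1 (equivalently, φ^(m+1) + φ^m = 1 where φ = √θ). -/

import Mathlib

open Classical in
/-- Asymptotic average code-length `L_m(θ)` of the modified Rice–Golomb code. -/
noncomputable def asympLen (m : ℕ) (θ : ℝ) : ℝ :=
  if ∃ β : ℕ, m = 2 ^ β then
    1 + Real.logb 2 m + θ ^ ((m : ℝ)/2) / (1 - θ ^ ((m : ℝ)/2))
  else
    1 + (Nat.log 2 m : ℝ) +
      θ ^ (((2 ^ Nat.clog 2 m - m : ℕ) : ℝ)/2) / (1 - θ ^ ((m : ℝ)/2))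

theorem rpow_natCast_div_two {θ : ℝ} (hθ : 0 ≤ θ) (n : ℕ) : θ ^ ((n : ℝ) / 2) = √θ ^ n := by
  rw [Real.sqrt_eq_rpow, ← Real.rpow_mul_natCast hθ]
  congr 1
  ring

/-- On each dyadic interval `[2 ^ k, 2 ^ (k + 1)]`, endpoints included, both branches of the
code-length are given by a single formula in `√θ`. -/
theorem asympLen_eq_of_mem_dyadic {θ : ℝ} (hθ : θ ∈ Set.Ioo (0 : ℝ) 1) {k m : ℕ}
    (hkm : 2 ^ k ≤ m) (hmk : m ≤ 2 ^ (k + 1)) :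
    asympLen m θ = 1 + k + √θ ^ (2 ^ (k + 1) - m) / (1 - √θ ^ m) := by
  have hφ : √θ < 1 := by rw [Real.sqrt_lt' one_pos]; simpa using hθ.2
  have hm : m ≠ 0 := (Nat.pos_of_ne_zero (by positivity) |>.trans_le hkm).ne'
  have hden : 1 - √θ ^ m ≠ 0 := (sub_pos.2 (pow_lt_one₀ (Real.sqrt_nonneg θ) hφ hm)).ne'
  unfold asympLen
  simp only [rpow_natCast_div_two hθ.1.le]
  rcases hkm.eq_or_lt with rfl | hlt
  · rw [if_pos ⟨k, rfl⟩, show 2 ^ (k + 1) - 2 ^ k = 2 ^ k by rw [pow_succ]; omega]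
    simp [Real.logb_pow]
  rcases hmk.eq_or_lt with rfl | hgt
  · rw [if_pos ⟨k + 1, rfl⟩, Nat.sub_self, pow_zero, Nat.cast_pow, Nat.cast_ofNat,
      Real.logb_pow, Real.logb_self_eq_one one_lt_two]
    push_cast
    field_simp
    ring
  · rw [if_neg, Nat.log_eq_of_pow_le_of_lt_pow hkm hgt,
      (Nat.clog_le_of_le_pow hmk).antisymm ((Nat.lt_clog_iff_pow_lt one_lt_two).2 hlt)]
    rintro ⟨β, rfl⟩
    rw [Nat.pow_lt_pow_iff_right one_lt_two] at hlt hgt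
    omega

/-- `L_m(θ) = L_{m+1}(θ)` iff `θ^((m+1)/2) + θ^(m/2) = 1`. -/
theorem intersection_equation (m : ℕ) (hm : 0 < m) (θ : ℝ) (hθ : θ ∈ Set.Ioo (0:ℝ) 1) :
    asympLen m θ = asympLen (m + 1) θ ↔
      θ ^ (((m : ℝ) + 1)/2) + θ ^ ((m : ℝ)/2) = 1 := by
  have hk : 2 ^ Nat.log 2 m ≤ m := Nat.pow_log_le_self 2 hm.ne'
  have hk' : m < 2 ^ (Nat.log 2 m + 1) := Nat.lt_pow_succ_log_self one_lt_two m
  have hφ₀ : 0 < √θ := Real.sqrt_pos.2 hθ.1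
  have hφ : √θ < 1 := by rw [Real.sqrt_lt' one_pos]; simpa using hθ.2
  have hden : 1 - √θ ^ m ≠ 0 := (sub_pos.2 (pow_lt_one₀ hφ₀.le hφ hm.ne')).ne'
  have hden' : 1 - √θ ^ (m + 1) ≠ 0 := (sub_pos.2 (pow_lt_one₀ hφ₀.le hφ m.succ_ne_zero)).ne'
  rw [asympLen_eq_of_mem_dyadic hθ hk hk'.le,
    asympLen_eq_of_mem_dyadic hθ (hk.trans m.le_succ) hk', add_right_inj,
    show 2 ^ (Nat.log 2 m + 1) - m = 2 ^ (Nat.log 2 m + 1) - (m + 1) + 1 by omega,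
    ← Nat.cast_add_one, rpow_natCast_div_two hθ.1.le, rpow_natCast_div_two hθ.1.le,
    div_eq_div_iff hden hden', pow_succ, mul_assoc, mul_right_inj' (pow_pos hφ₀ _).ne']
  have hne : 1 - √θ ≠ 0 := (sub_pos.2 hφ).ne'
  constructor
  · intro h
    apply mul_left_cancel₀ hne
    linear_combination h
  · intro h
    linear_combination (1 - √θ) * h
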